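/- Every bridgeless cubic graph has a perfect matching. -/

import Mathlib

namespace SimpleGraph

variable {V : Type*} (G : SimpleGraph V) [DecidableRel G.Adj]

lemma even_card_interedges_self (S : Finset V) : Even (G.interedges S S).card := by
  rw [← ZMod.natCast_eq_zero_iff_even, Finset.cast_card]
  refine Finset.sum_involution (fun x _ ↦ x.swap) (fun _ _ ↦ by decide) ?_ ?_ (by simp)
  · rintro ⟨a, b⟩ h - he
    simp only [mem_interedges_iff] at h
    exact h.2.2.ne (congrArg Prod.snd he)
  · rintro ⟨a, b⟩ h
    simp only [mem_interedges_iff, Prod.swap] at h ⊢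
    exact ⟨h.2.1, h.1, h.2.2.symm⟩

variable [Fintype V] [DecidableEq V]

lemma card_interedges_univ (S : Finset V) :
    (G.interedges S Finset.univ).card = ∑ v ∈ S, G.degree v := by
  rw [Finset.card_eq_sum_card_fiberwise (f := Prod.fst) (t := S)
    (fun x hx ↦ (G.mem_interedges_iff.1 hx).1)]
  refine Finset.sum_congr rfl fun v hv ↦ ?_
  rw [← card_neighborFinset_eq_degree]
  refine Finset.card_bij' (fun x _ ↦ x.2) (fun w _ ↦ (v, w)) ?_ ?_ ?_ ?_ <;>
    simp only [Finset.mem_filter, mem_interedges_iff, mem_neighborFinset] <;> grind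

lemma card_interedges_self_add_compl (S : Finset V) :
    (G.interedges S S).card + (G.interedges S Sᶜ).card = ∑ v ∈ S, G.degree v := by
  rw [← card_interedges_univ, ← Finset.card_union_of_disjoint
    (G.interedges_disjoint_right S disjoint_compl_right)]
  congr 1
  ext x
  simp only [Finset.mem_union, mem_interedges_iff, Finset.mem_compl, Finset.mem_univ]
  tauto

variable {G}

/-- In a bridgeless graph no edge cut consists of a single edge. -/
lemma card_interedges_compl_ne_one (hb : ∀ e ∈ G.edgeSet, ¬ G.IsBridge e) (S : Finset V) :
    (G.interedges S Sᶜ).card ≠ 1 := by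
  intro h
  obtain ⟨⟨a, b⟩, hab⟩ := Finset.card_eq_one.1 h
  obtain ⟨ha, hbS, hadj⟩ : a ∈ S ∧ b ∈ Sᶜ ∧ G.Adj a b :=
    G.mk_mem_interedges_iff.1 (hab ▸ Finset.mem_singleton_self _)
  have hr := hb s(a, b) hadj
  rw [isBridge_iff, not_not] at hr
  obtain ⟨p⟩ := hr
  obtain ⟨d, -, hd₁, hd₂⟩ := p.exists_boundary_dart (S : Set V) ha (by simpa using hbS)
  have hd := d.adj
  rw [deleteEdges_adj] at hd
  have hmem : (d.fst, d.snd) ∈ G.interedges S Sᶜ :=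
    G.mk_mem_interedges_iff.2 ⟨hd₁, by simpa using hd₂, hd.1⟩
  rw [hab, Finset.mem_singleton, Prod.mk.injEq] at hmem
  exact hd.2 (by simp [hmem.1, hmem.2])

lemma three_le_card_interedges_compl (hc : ∀ v, G.degree v = 3)
    (hb : ∀ e ∈ G.edgeSet, ¬ G.IsBridge e) {S : Finset V} (hS : Odd S.card) :
    3 ≤ (G.interedges S Sᶜ).card := by
  have h₁ := G.card_interedges_self_add_compl S
  have h₂ := G.even_card_interedges_self S
  have h₃ := card_interedges_compl_ne_one hb S
  simp only [hc, Finset.sum_const, smul_eq_mul] at h₁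
  grind

/-- **Petersen's theorem** for graphs that need not be connected. -/
theorem exists_isPerfectMatching_of_cubic (hc : ∀ v, G.degree v = 3)
    (hb : ∀ e ∈ G.edgeSet, ¬ G.IsBridge e) : ∃ M : G.Subgraph, M.IsPerfectMatching := by
  classical
  refine tutte.2 fun u hu ↦ ?_
  let H := ((⊤ : G.Subgraph).deleteVerts u).coe
  let U : Finset V := u.toFinset
  let S (c : H.ConnectedComponent) : Finset V := (Subtype.val '' c.supp).toFinset
  let C : Finset H.ConnectedComponent := H.oddComponents.toFinset
  have mem_S {c : H.ConnectedComponent} {v : V} :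
      v ∈ S c ↔ ∃ h, H.connectedComponentMk ⟨v, h⟩ = c := by
    simp only [S, Set.mem_toFinset, Set.mem_image, ConnectedComponent.mem_supp_iff, Subtype.exists]
    grind
  have compl_S (c : H.ConnectedComponent) : G.interedges (S c) (S c)ᶜ ⊆ G.interedges (S c) U := by
    rintro ⟨a, b⟩ hx
    rw [mk_mem_interedges_iff, Finset.mem_compl] at hx
    obtain ⟨ha, hbS, hadj⟩ := hx
    refine G.mk_mem_interedges_iff.2 ⟨ha, ?_, hadj⟩
    by_contra hbu
    obtain ⟨ha', rfl⟩ := mem_S.1 ha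
    have hau : a ∉ u := by simpa using ha'
    have hbu : b ∉ u := by simpa [U] using hbu
    refine hbS (mem_S.2 ⟨by simpa using hbu, ?_⟩)
    refine ConnectedComponent.sound (Adj.reachable ?_)
    simp [H, hau, hbu, hadj.symm]
  have three_le (c) (hcC : c ∈ C) : 3 ≤ (G.interedges (S c) U).card := by
    refine (three_le_card_interedges_compl hc hb ?_).trans (Finset.card_le_card (compl_S c))
    have hodd : Odd c.supp.ncard := by simpa [C] using hcC
    rwa [← Set.ncard_eq_toFinset_card', Set.ncard_image_of_injective _ Subtype.val_injective]
  have hdisj : (C : Set H.ConnectedComponent).PairwiseDisjoint fun c ↦ G.interedges (S c) U := by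
    intro c _ d _ hcd
    refine G.interedges_disjoint_left (Finset.disjoint_left.2 fun v hv hv' ↦ hcd ?_) U
    obtain ⟨_, rfl⟩ := mem_S.1 hv
    obtain ⟨_, rfl⟩ := mem_S.1 hv'
    rfl
  have key : C.card * 3 ≤ U.card * 3 := calc
    C.card * 3 ≤ ∑ c ∈ C, (G.interedges (S c) U).card := by
      simpa using Finset.card_nsmul_le_sum C _ 3 three_le
    _ = (C.biUnion fun c ↦ G.interedges (S c) U).card := (Finset.card_biUnion hdisj).symm
    _ ≤ (G.interedges Finset.univ U).card := Finset.card_le_card <|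
      Finset.biUnion_subset.2 fun c _ ↦ G.interedges_mono (Finset.subset_univ _) subset_rfl
    _ = (G.interedges U Finset.univ).card :=
      have : Std.Symm G.Adj := ⟨fun _ _ h ↦ h.symm⟩
      Rel.card_interedges_comm _ _
    _ = U.card * 3 := by simp [card_interedges_univ, hc]
  have hlt : u.ncard < H.oddComponents.ncard := hu
  rw [Set.ncard_eq_toFinset_card', Set.ncard_eq_toFinset_card'] at hlt
  exact absurd hlt (not_lt.2 (Nat.le_of_mul_le_mul_right key three_pos))

end SimpleGraph


/-- Petersen's theorem: every bridgeless cubic graph has a perfect matching. -/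
theorem bridgeless_cubic_has_perfect_matching
    {V : Type*} [Fintype V] [DecidableEq V] (G : SimpleGraph V) [DecidableRel G.Adj]
    (hcubic : ∀ v : V, G.degree v = 3)
    (hbridgeless : ∀ e : Sym2 V, ¬ G.IsBridge e) :
    ∃ M : G.Subgraph, M.IsPerfectMatching := by
  exact SimpleGraph.exists_isPerfectMatching_of_cubic hcubic fun e _ ↦ hbridgeless e
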